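/- The transpose automorphism preserves the dual canonical basis: σ(B*) = B*, where σ is the K-algebra automorphism of O_q(M(n)) determined by σ(x_{ij}) = x_{ji}. -/

import Mathlib

open scoped TensorProduct

set_option synthInstance.maxHeartbeats 1000000
set_option maxHeartbeats 1000000

noncomputable section

/-- The base field `K = ℚ(q)`. -/
abbrev Kq : Type := RatFunc ℚ

/-- The indeterminate `q ∈ ℚ(q)`. -/
noncomputable def qq : Kq := RatFunc.X

/-- Matrices with nonnegative integer entries. -/
abbrev Mat (n : ℕ) := Matrix (Fin n) (Fin n) ℕ

/-- The defining relations of the quantum matrix algebra `O_q(M(n))`. -/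
inductive OqRel (n : ℕ) :
    FreeAlgebra Kq (Fin n × Fin n) → FreeAlgebra Kq (Fin n × Fin n) → Prop
  | rel_row {i j k : Fin n} (h : j < k) :
      OqRel n (FreeAlgebra.ι Kq (i, j) * FreeAlgebra.ι Kq (i, k))
        ((qq ^ 2) • (FreeAlgebra.ι Kq (i, k) * FreeAlgebra.ι Kq (i, j)))
  | rel_col {i k j : Fin n} (h : i < k) :
      OqRel n (FreeAlgebra.ι Kq (i, j) * FreeAlgebra.ι Kq (k, j))
        ((qq ^ 2) • (FreeAlgebra.ι Kq (k, j) * FreeAlgebra.ι Kq (i, j)))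
  | rel_anti {i j s t : Fin n} (h1 : s < i) (h2 : j < t) :
      OqRel n (FreeAlgebra.ι Kq (i, j) * FreeAlgebra.ι Kq (s, t))
        (FreeAlgebra.ι Kq (s, t) * FreeAlgebra.ι Kq (i, j))
  | rel_diag {i j s t : Fin n} (h1 : i < s) (h2 : j < t) :
      OqRel n (FreeAlgebra.ι Kq (i, j) * FreeAlgebra.ι Kq (s, t))
        (FreeAlgebra.ι Kq (s, t) * FreeAlgebra.ι Kq (i, j)
          + (qq ^ 2 - qq⁻¹ ^ 2) • (FreeAlgebra.ι Kq (i, t) * FreeAlgebra.ι Kq (s, j)))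

/-- The quantum matrix algebra `O_q(M(n))`. -/
abbrev Oq (n : ℕ) := RingQuot (OqRel n)

/-- The generator `x_{ij}` of `O_q(M(n))`. -/
noncomputable def xgen (n : ℕ) (i j : Fin n) : Oq n :=
  RingQuot.mkAlgHom Kq (OqRel n) (FreeAlgebra.ι Kq (i, j))

/-- The lexicographically ordered monomial `x^A`. -/
noncomputable def xMon (n : ℕ) (A : Mat n) : Oq n :=
  ((List.finRange n).map fun i =>
    ((List.finRange n).map fun j => xgen n i j ^ A i j).prod).prod
/-- The exponent appearing in `E(A)` and `D(A)`. -/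
def eExp (n : ℕ) (A : Mat n) : ℕ :=
  ∑ i, ∑ j, ∑ k ∈ Finset.univ.filter (fun k => k < j), (A i j * A i k + A j i * A k i)

/-- The modified monomial `x(A) = D(A) x^A`. -/
noncomputable def xMod (n : ℕ) (A : Mat n) : Oq n := (qq ^ (-(eExp n A : ℤ))) • xMon n A

/-- `matStep M M'` : `M'` is obtained from `M` by a single 2×2 submatrix transformation. -/
def matStep (n : ℕ) (M M' : Mat n) : Prop :=
  ∃ i s j t : Fin n, i < s ∧ j < t ∧ 1 ≤ M i j ∧ 1 ≤ M s t ∧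
    M' i j = M i j - 1 ∧ M' s t = M s t - 1 ∧ M' i t = M i t + 1 ∧ M' s j = M s j + 1 ∧
    ∀ u v : Fin n,
      ¬((u = i ∧ v = j) ∨ (u = s ∧ v = t) ∨ (u = i ∧ v = t) ∨ (u = s ∧ v = j)) →
        M' u v = M u v

/-- `matLT B A` : `B < A`, i.e. `B` is obtained from `A` by a nonempty sequence of
2×2 submatrix transformations. -/
def matLT (n : ℕ) (B A : Mat n) : Prop := Relation.TransGen (matStep n) A B

/-- Membership in `ℤ[q] ⊆ ℚ(q)`. -/
def inZq (c : Kq) : Prop := c ∈ Subring.closure ({qq} : Set Kq)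

/-- Membership in `qℤ[q] ⊆ ℚ(q)`. -/
def inQZq (c : Kq) : Prop := ∃ d : Kq, inZq d ∧ c = qq * d

/-- Membership in `ℤ[q, q⁻¹] ⊆ ℚ(q)`. -/
def inZLaurent (c : Kq) : Prop := c ∈ Subring.closure ({qq, qq⁻¹} : Set Kq)

/-- `bar` is the bar involution: a `ℚ`-algebra anti-automorphism fixing the `x_{ij}`
and semilinear with respect to `q ↦ q⁻¹`. -/
def IsBar (n : ℕ) (bar : Oq n → Oq n) : Prop :=
  Function.Bijective bar ∧
  (∀ a b : Oq n, bar (a + b) = bar a + bar b) ∧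
  (∀ (r : ℚ) (a : Oq n), bar ((r : Kq) • a) = (r : Kq) • bar a) ∧
  (∀ a b : Oq n, bar (a * b) = bar b * bar a) ∧
  bar 1 = 1 ∧
  (∀ i j, bar (xgen n i j) = xgen n i j) ∧
  (∀ a : Oq n, bar (qq • a) = qq⁻¹ • bar a)

/-- Membership in the `ℤ[q]`-lattice `L* = ⊕_A ℤ[q]·x(A)`. -/
def memLstar (n : ℕ) (v : Oq n) : Prop :=
  ∃ (F : Finset (Mat n)) (h : Mat n → Kq),
    (∀ A ∈ F, inZq (h A)) ∧ v = ∑ A ∈ F, h A • xMod n A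

/-- `b` is the dual canonical basis of `O_q(M(n))` relative to the bar involution `bar`:
each `b A` is bar-invariant, is `x(A)` plus a `qℤ[q]`-combination of `x(B)` with `B < A`,
and the family is a `ℤ[q]`-basis of `L*`. -/
def IsDCB (n : ℕ) (bar : Oq n → Oq n) (b : Mat n → Oq n) : Prop :=
  (∀ A, bar (b A) = b A) ∧
  (∀ A, ∃ (F : Finset (Mat n)) (h : Mat n → Kq),
      (∀ B ∈ F, matLT n B A ∧ inQZq (h B)) ∧
      b A = xMod n A + ∑ B ∈ F, h B • xMod n B) ∧
  (∀ v, memLstar n v → ∃ (F : Finset (Mat n)) (h : Mat n → Kq),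
      (∀ A ∈ F, inZq (h A)) ∧ v = ∑ A ∈ F, h A • b A) ∧
  (∀ (F : Finset (Mat n)) (h : Mat n → Kq), (∀ A ∈ F, inZq (h A)) →
      ∑ A ∈ F, h A • b A = 0 → ∀ A ∈ F, h A = 0)
open Polynomial in
/-- Evaluation at `q` embeds `ℤ[X]` into `ℚ(q)`. -/
lemma aeval_qq_injective : Function.Injective (aeval qq : ℤ[X] →ₐ[ℤ] Kq) := by
  have h : ∀ p : ℤ[X],
      aeval qq p = algebraMap ℚ[X] Kq (p.map (Int.castRingHom ℚ)) := by
    intro p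
    induction p using Polynomial.induction_on' with
    | add p r hp hr => simp only [map_add, Polynomial.map_add, hp, hr]
    | monomial k a =>
      rw [← C_mul_X_pow_eq_monomial]
      simp [qq]
  intro p r hpr
  rw [h, h] at hpr
  exact map_injective _ Int.cast_injective (RatFunc.algebraMap_injective ℚ hpr)

lemma qq_ne_zero : qq ≠ 0 := RatFunc.X_ne_zero

open Polynomial in
lemma inZq_iff_exists_aeval {c : Kq} : inZq c ↔ ∃ p : ℤ[X], c = aeval qq p := by
  constructor
  · intro h
    induction h using Subring.closure_induction with
    | mem x hx => exact ⟨X, by rw [aeval_X]; exact hx⟩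
    | zero => exact ⟨0, by simp⟩
    | one => exact ⟨1, by simp⟩
    | add x y _ _ hx hy =>
      obtain ⟨p, rfl⟩ := hx
      obtain ⟨r, rfl⟩ := hy
      exact ⟨p + r, by simp⟩
    | neg x _ hx =>
      obtain ⟨p, rfl⟩ := hx
      exact ⟨-p, by simp⟩
    | mul x y _ _ hx hy =>
      obtain ⟨p, rfl⟩ := hx
      obtain ⟨r, rfl⟩ := hy
      exact ⟨p * r, by simp⟩
  · rintro ⟨p, rfl⟩
    induction p using Polynomial.induction_on' with
    | add p r hp hr => rw [map_add]; exact add_mem hp hr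
    | monomial k a =>
      rw [aeval_monomial]
      refine mul_mem ?_ (pow_mem (Subring.subset_closure (Set.mem_singleton qq)) k)
      simp only [eq_intCast]
      exact intCast_mem _ a

lemma list_prod_mul_distrib_of_pairwise {ι R : Type*} [Monoid R] (a g : ι → R) (l : List ι)
    (h : l.Pairwise fun j k => Commute (g j) (a k)) :
    (l.map a).prod * (l.map g).prod = (l.map fun j => a j * g j).prod := by
  induction l with
  | nil => simp
  | cons j l ih =>
    rw [List.pairwise_cons] at h
    simp only [List.map_cons, List.prod_cons]
    rw [← ih h.2]
    have hc : Commute (g j) (l.map a).prod :=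
      Commute.list_prod_right _ _ (by simpa using h.1)
    simp only [mul_assoc]
    rw [← mul_assoc (l.map a).prod, ← hc.eq, mul_assoc]

/-- A double product may be taken row by row or column by column as soon as the entries in
antidiagonal position commute. -/
lemma list_prod_prod_comm_of_pairwise {ι κ R : Type*} [Preorder ι] [Preorder κ] [Monoid R]
    (f : ι → κ → R) (h : ∀ i s j t, i < s → j < t → Commute (f s j) (f i t))
    (l : List ι) (m : List κ) (hl : l.Pairwise (· < ·)) (hm : m.Pairwise (· < ·)) :
    (l.map fun i => (m.map fun j => f i j).prod).prod =
      (m.map fun j => (l.map fun i => f i j).prod).prod := by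
  induction l with
  | nil => simp
  | cons i l ih =>
    rw [List.pairwise_cons] at hl
    simp only [List.map_cons, List.prod_cons]
    rw [ih hl.2]
    refine list_prod_mul_distrib_of_pairwise _ _ m (hm.imp fun {j k} hjk => ?_)
    refine Commute.list_prod_left _ _ fun y hy => ?_
    obtain ⟨s, hs, rfl⟩ := List.mem_map.mp hy
    exact h i s j k (hl.1 s hs) hjk

lemma commute_xgen_of_lt (n : ℕ) {i s j t : Fin n} (h1 : i < s) (h2 : j < t) :
    Commute (xgen n s j) (xgen n i t) := by
  have := RingQuot.mkAlgHom_rel Kq (OqRel.rel_anti h1 h2)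
  rwa [map_mul, map_mul] at this

lemma xMon_eq_prod_columns (n : ℕ) (A : Mat n) :
    xMon n A = ((List.finRange n).map fun j =>
      ((List.finRange n).map fun i => xgen n i j ^ A i j).prod).prod :=
  list_prod_prod_comm_of_pairwise (fun i j => xgen n i j ^ A i j)
    (fun _ _ _ _ h1 h2 => (commute_xgen_of_lt n h1 h2).pow_pow _ _) _ _
    (List.pairwise_lt_finRange n) (List.pairwise_lt_finRange n)

lemma eExp_transpose (n : ℕ) (A : Mat n) : eExp n A.transpose = eExp n A := by
  simp only [eExp, Matrix.transpose_apply, add_comm]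

section Transpose

variable {n : ℕ} {σ : Oq n ≃ₐ[Kq] Oq n}

lemma map_xMon_transpose (hσ : ∀ i j, σ (xgen n i j) = xgen n j i) (A : Mat n) :
    σ (xMon n A) = xMon n A.transpose := by
  rw [xMon_eq_prod_columns n A.transpose, xMon]
  simp only [map_list_prod, List.map_map, Function.comp_def, map_pow, hσ, Matrix.transpose_apply]

lemma map_xMod_transpose (hσ : ∀ i j, σ (xgen n i j) = xgen n j i) (A : Mat n) :
    σ (xMod n A) = xMod n A.transpose := by
  rw [xMod, xMod, map_smul, map_xMon_transpose hσ, eExp_transpose]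

end Transpose

section Bar

variable {n : ℕ} {bar : Oq n → Oq n}

lemma IsBar.map_zero (hbar : IsBar n bar) : bar 0 = 0 := by
  simpa using hbar.2.1 0 0

lemma IsBar.map_sub (hbar : IsBar n bar) (a c : Oq n) : bar (a - c) = bar a - bar c := by
  rw [eq_sub_iff_add_eq, ← hbar.2.1, sub_add_cancel]

lemma IsBar.map_sum (hbar : IsBar n bar) {ι : Type*} (F : Finset ι) (f : ι → Oq n) :
    bar (∑ i ∈ F, f i) = ∑ i ∈ F, bar (f i) :=
  _root_.map_sum (⟨⟨bar, hbar.map_zero⟩, hbar.2.1⟩ : Oq n →+ Oq n) f F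

lemma IsBar.map_inv_smul (hbar : IsBar n bar) (a : Oq n) : bar (qq⁻¹ • a) = qq • bar a := by
  have h := hbar.2.2.2.2.2.2 (qq⁻¹ • a)
  rw [smul_inv_smul₀ qq_ne_zero] at h
  rw [h, smul_inv_smul₀ qq_ne_zero]

lemma IsBar.map_pow_smul (hbar : IsBar n bar) (k : ℕ) (a : Oq n) :
    bar (qq ^ k • a) = qq⁻¹ ^ k • bar a := by
  induction k with
  | zero => simp
  | succ k ih => rw [pow_succ', pow_succ', mul_smul, mul_smul, hbar.2.2.2.2.2.2, ih]

open Polynomial in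
lemma IsBar.map_aeval_smul (hbar : IsBar n bar) (p : ℤ[X]) (a : Oq n) :
    bar (aeval qq p • a) = aeval qq⁻¹ p • bar a := by
  induction p using Polynomial.induction_on' with
  | add p r hp hr => simp only [map_add, add_smul, hbar.2.1, hp, hr]
  | monomial k c =>
    simp only [aeval_monomial, mul_smul, eq_intCast]
    have h := hbar.2.2.1 c (qq ^ k • a)
    rw [hbar.map_pow_smul] at h
    simpa using h

/-- The elements on which `σ` and `bar` commute. -/
def barCommSubring (hbar : IsBar n bar) (σ : Oq n ≃ₐ[Kq] Oq n) : Subring (Oq n) where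
  carrier := {a | bar (σ a) = σ (bar a)}
  mul_mem' {a c} ha hc := by
    simp only [Set.mem_ofPred_eq] at *
    rw [map_mul, hbar.2.2.2.1, ha, hc, hbar.2.2.2.1, map_mul]
  one_mem' := by simp [hbar.2.2.2.2.1]
  add_mem' {a c} ha hc := by
    simp only [Set.mem_ofPred_eq] at *
    rw [map_add, hbar.2.1, ha, hc, hbar.2.1, map_add]
  zero_mem' := by simp [hbar.map_zero]
  neg_mem' {a} ha := by
    simp only [Set.mem_ofPred_eq] at *
    rw [← zero_sub, _root_.map_sub, hbar.map_sub, ha, hbar.map_sub, _root_.map_sub]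
    simp [hbar.map_zero]

variable {σ : Oq n ≃ₐ[Kq] Oq n}

lemma smul_mem_barCommSubring (hbar : IsBar n bar) {c : Kq} (hc : inZq c) {a : Oq n}
    (ha : a ∈ barCommSubring hbar σ) : c • a ∈ barCommSubring hbar σ := by
  obtain ⟨p, rfl⟩ := inZq_iff_exists_aeval.mp hc
  change bar (σ _) = σ (bar _)
  rw [map_smul, hbar.map_aeval_smul, hbar.map_aeval_smul, map_smul]
  exact congrArg _ ha

lemma xMod_mem_barCommSubring (hbar : IsBar n bar)
    (hσ : ∀ i j, σ (xgen n i j) = xgen n j i) (A : Mat n) :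
    xMod n A ∈ barCommSubring hbar σ := by
  have hgen : ∀ i j, xgen n i j ∈ barCommSubring hbar σ := fun i j => by
    change bar (σ _) = σ (bar _)
    rw [hσ, hbar.2.2.2.2.2.1, hbar.2.2.2.2.2.1, hσ]
  have hmon : xMon n A ∈ barCommSubring hbar σ := by
    refine Subring.list_prod_mem _ fun y hy => ?_
    obtain ⟨i, -, rfl⟩ := List.mem_map.mp hy
    refine Subring.list_prod_mem _ fun y hy => ?_
    obtain ⟨j, -, rfl⟩ := List.mem_map.mp hy
    exact pow_mem (hgen i j) _
  have hinv : ∀ (k : ℕ) (a : Oq n), a ∈ barCommSubring hbar σ →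
      qq⁻¹ ^ k • a ∈ barCommSubring hbar σ := by
    intro k a ha
    induction k with
    | zero => simpa using ha
    | succ k ih =>
      rw [pow_succ', mul_smul]
      change bar (σ _) = σ (bar _)
      rw [map_smul, hbar.map_inv_smul, hbar.map_inv_smul, map_smul σ qq]
      exact congrArg (qq • ·) ih
  have := hinv (eExp n A) _ hmon
  rwa [inv_pow, ← zpow_natCast, ← zpow_neg] at this

end Bar

lemma Oq.neg_smul {n : ℕ} (c : Kq) (a : Oq n) : -c • a = -(c • a) := by
  rw [eq_neg_iff_add_eq_zero, ← add_smul, neg_add_cancel, zero_smul]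

lemma Oq.sub_smul {n : ℕ} (c d : Kq) (a : Oq n) : (c - d) • a = c • a - d • a := by
  rw [sub_eq_add_neg, add_smul, Oq.neg_smul, ← sub_eq_add_neg]

lemma memLstar.add {n : ℕ} {v w : Oq n} (hv : memLstar n v) (hw : memLstar n w) :
    memLstar n (v + w) := by
  classical
  obtain ⟨F, f, hf, rfl⟩ := hv
  obtain ⟨G, g, hg, rfl⟩ := hw
  refine ⟨F ∪ G, fun A => (if A ∈ F then f A else 0) + (if A ∈ G then g A else 0), ?_, ?_⟩
  · intro A _
    refine add_mem ?_ ?_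
    · split_ifs with h
      exacts [hf A h, zero_mem _]
    · split_ifs with h
      exacts [hg A h, zero_mem _]
  · simp only [add_smul, Finset.sum_add_distrib, ite_smul, zero_smul, Finset.sum_ite_mem,
      Finset.union_inter_cancel_left, Finset.union_inter_cancel_right]

lemma memLstar.neg {n : ℕ} {v : Oq n} (hv : memLstar n v) : memLstar n (-v) := by
  obtain ⟨F, f, hf, rfl⟩ := hv
  exact ⟨F, fun A => -f A, fun A hA => neg_mem (hf A hA), by
    rw [← Finset.sum_neg_distrib]
    exact Finset.sum_congr rfl fun A _ => (Oq.neg_smul _ _).symm⟩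

lemma memLstar_smul_xMod {n : ℕ} {c : Kq} (hc : inZq c) (A : Mat n) :
    memLstar n (c • xMod n A) :=
  ⟨{A}, fun _ => c, fun _ _ => hc, by simp⟩

lemma exists_memLstar_sum_eq_smul {n : ℕ} {ι : Type*} (F : Finset ι) (h : ι → Kq)
    (e : ι → Mat n) (hF : ∀ i ∈ F, inQZq (h i)) :
    ∃ w, memLstar n w ∧ ∑ i ∈ F, h i • xMod n (e i) = qq • w := by
  classical
  induction F using Finset.induction_on with
  | empty => exact ⟨0, ⟨∅, 0, by simp, by simp⟩, by simp⟩
  | insert i F hi ih =>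
    obtain ⟨w, hw, hsum⟩ := ih fun k hk => hF k (Finset.mem_insert_of_mem hk)
    obtain ⟨d, hd, hid⟩ := hF i (Finset.mem_insert_self i F)
    refine ⟨d • xMod n (e i) + w, (memLstar_smul_xMod hd _).add hw, ?_⟩
    rw [Finset.sum_insert hi, hsum, hid, mul_smul, smul_add]

open Polynomial in
/-- A bar-invariant element of `q L*` vanishes. -/
lemma IsDCB.eq_zero_of_bar_eq {n : ℕ} {bar : Oq n → Oq n} {b : Mat n → Oq n}
    (hbar : IsBar n bar) (hb : IsDCB n bar b) {w : Oq n} (hw : memLstar n w)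
    (hinv : bar (qq • w) = qq • w) : qq • w = 0 := by
  obtain ⟨hbb, -, hspan, hind⟩ := hb
  obtain ⟨F, h, hF, rfl⟩ := hspan w hw
  have hex : ∀ A, ∃ p : ℤ[X], A ∈ F → h A = aeval qq p := fun A => by
    by_cases hA : A ∈ F
    · obtain ⟨p, hp⟩ := inZq_iff_exists_aeval.mp (hF A hA)
      exact ⟨p, fun _ => hp⟩
    · exact ⟨0, fun hA' => absurd hA' hA⟩
  choose p hp using hex
  obtain ⟨N, hN⟩ : ∃ N, ∀ A ∈ F, (p A).natDegree ≤ N :=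
    ⟨F.sup fun A => (p A).natDegree, fun A hA => Finset.le_sup (f := fun A => (p A).natDegree) hA⟩
  have hsum : ∑ A ∈ F, h A • b A = ∑ A ∈ F, aeval qq (p A) • b A :=
    Finset.sum_congr rfl fun A hA => by rw [hp A hA]
  have hreflect : ∀ A ∈ F, qq ^ N * aeval qq⁻¹ (p A) = aeval qq (reflect N (p A)) := by
    intro A hA
    let := invertibleOfNonzero (inv_ne_zero qq_ne_zero)
    have hu := eval₂_reflect_mul_pow (algebraMap ℤ Kq) qq⁻¹ N (p A) (hN A hA)
    rw [invOf_eq_inv, inv_inv] at hu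
    rw [aeval_def, aeval_def, ← hu, mul_left_comm, ← mul_pow, mul_inv_cancel₀ qq_ne_zero,
      one_pow, mul_one]
  rw [hsum, hbar.2.2.2.2.2.2, hbar.map_sum] at hinv
  simp only [hbar.map_aeval_smul, hbb] at hinv
  have hrel : ∑ A ∈ F, aeval qq (X ^ (N + 2) * p A - reflect N (p A)) • b A = 0 := by
    have h1 : ∑ A ∈ F, aeval qq (X ^ (N + 2) * p A) • b A =
        qq ^ (N + 1) • qq • ∑ A ∈ F, aeval qq (p A) • b A := by
      simp only [Finset.smul_sum, smul_smul]
      refine Finset.sum_congr rfl fun A _ => ?_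
      congr 1
      simp only [map_mul, map_pow, aeval_X]
      ring
    have h2 : ∑ A ∈ F, aeval qq (reflect N (p A)) • b A =
        qq ^ (N + 1) • qq⁻¹ • ∑ A ∈ F, aeval qq⁻¹ (p A) • b A := by
      simp only [Finset.smul_sum, smul_smul]
      refine Finset.sum_congr rfl fun A hA => ?_
      rw [← hreflect A hA, pow_succ]
      congr 1
      field_simp [qq_ne_zero]
    have h3 := Finset.sum_sub_distrib (s := F) (fun A => aeval qq (X ^ (N + 2) * p A) • b A)
      fun A => aeval qq (reflect N (p A)) • b A
    rw [h1, h2, hinv, sub_self] at h3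
    rw [← h3]
    refine Finset.sum_congr rfl fun A _ => ?_
    rw [_root_.map_sub]
    exact Oq.sub_smul _ _ _
  have hzero := hind F _ (fun A _ => inZq_iff_exists_aeval.mpr ⟨_, rfl⟩) hrel
  have hpz : ∀ A ∈ F, p A = 0 := by
    intro A hA
    have hAz := aeval_qq_injective ((hzero A hA).trans (map_zero _).symm)
    by_contra hne
    have hdeg := congrArg natDegree (sub_eq_zero.mp hAz)
    rw [natDegree_X_pow_mul _ hne] at hdeg
    have hle := natDegree_reflect_le (p := p A) (N := N)
    have := hN A hA
    omega
  rw [Finset.sum_eq_zero fun A hA => by rw [hp A hA, hpz A hA]; simp, smul_zero]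

/-- The transpose automorphism sends the basis element of `A` to that of `Aᵀ`. -/
lemma IsDCB.map_transpose {n : ℕ} {bar : Oq n → Oq n} {b : Mat n → Oq n}
    (hbar : IsBar n bar) (hb : IsDCB n bar b) {σ : Oq n ≃ₐ[Kq] Oq n}
    (hσ : ∀ i j, σ (xgen n i j) = xgen n j i) (A : Mat n) :
    σ (b A) = b A.transpose := by
  obtain ⟨F, h, hF, hA⟩ := hb.2.1 A
  obtain ⟨G, g, hG, hAt⟩ := hb.2.1 A.transpose
  obtain ⟨w, hw, hFw⟩ := exists_memLstar_sum_eq_smul F h Matrix.transpose fun B hB => (hF B hB).2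
  obtain ⟨z, hz, hGz⟩ := exists_memLstar_sum_eq_smul G g id fun B hB => (hG B hB).2
  have hcomm : b A ∈ barCommSubring hbar σ := by
    rw [hA]
    refine add_mem (xMod_mem_barCommSubring hbar hσ A) (sum_mem fun B hB => ?_)
    obtain ⟨d, hd, hBd⟩ := (hF B hB).2
    refine smul_mem_barCommSubring hbar ?_ (xMod_mem_barCommSubring hbar hσ B)
    rw [hBd]
    exact mul_mem (Subring.subset_closure (Set.mem_singleton qq)) hd
  have hdiff : σ (b A) - b A.transpose = qq • (w + -z) := by
    simp only [id] at hGz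
    rw [hAt, hA, hGz]
    simp only [map_add, map_sum, map_smul, map_xMod_transpose hσ]
    rw [hFw, smul_add, smul_neg]
    abel
  have hinv : bar (qq • (w + -z)) = qq • (w + -z) := by
    rw [← hdiff, hbar.map_sub, hb.1, show bar (σ (b A)) = σ (bar (b A)) from hcomm, hb.1]
  rw [← sub_eq_zero, hdiff]
  exact hb.eq_zero_of_bar_eq hbar (hw.add hz.neg) hinv

/-- The transpose automorphism `σ` (determined by `σ(x_{ij}) = x_{ji}`)
preserves the dual canonical basis: `σ(B*) = B*`. -/
theorem dual_canonical_basis_transpose_invariant (n : ℕ) (bar : Oq n → Oq n)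
    (hbar : IsBar n bar) (b : Mat n → Oq n) (hb : IsDCB n bar b)
    (σ : Oq n ≃ₐ[Kq] Oq n) (hσ : ∀ i j, σ (xgen n i j) = xgen n j i) :
    σ '' Set.range b = Set.range b := by
  rw [← Set.range_comp,
    show σ ∘ b = b ∘ Matrix.transpose from funext fun A => hb.map_transpose hbar hσ A]
  exact Function.Surjective.range_comp (fun A => ⟨A.transpose, A.transpose_transpose⟩) b
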